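/- arXiv:math/0310085 — 4 statements merged into one kernel-verified Lean document; each statement's English description precedes it below -/
import Mathlib

section
/- Let g ≥ 1, let τ be an element of the Siegel upper half-space H_g, let i, j ∈ {1,…,g}, and let ε, δ, β ∈ {0,1}^g ⊂ ℤ^g be such that both [ε,δ] and [ε,β+δ] are odd characteristics (i.e. ε·δ and ε·(β+δ) are odd integers). Then C^β_{ij,εδ}(τ) = (1/2) Σ_{α ∈ {0,1}^g} (−1)^{α·δ} A^β_{ij,(ε+α)α}(τ), where the sum ranges over the 2^g vectors α ∈ {0,1}^g ⊂ ℤ^g and sums of characteristics such as ε+α and β+δ are literal sums of integer vectors. -/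
open scoped BigOperators
open Complex

noncomputable section

/-- The Siegel upper half-space condition: a complex symmetric `g × g` matrix
whose imaginary part is positive definite. -/
def IsSiegel {g : ℕ} (τ : Matrix (Fin g) (Fin g) ℂ) : Prop :=
  τ.IsSymm ∧ Matrix.PosDef (Matrix.of fun i j => (τ i j).im)

/-- The theta function with characteristic `[ε, δ]`:
`θ[ε,δ](τ,z) = Σ_{m ∈ ℤ^g} exp(πi((m+ε/2)ᵀτ(m+ε/2) + 2(m+ε/2)·(z+δ/2)))`. -/
def theta {g : ℕ} (τ : Matrix (Fin g) (Fin g) ℂ) (ε δ : Fin g → ℤ)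
    (z : Fin g → ℂ) : ℂ :=
  ∑' m : Fin g → ℤ,
    Complex.exp (↑Real.pi * Complex.I *
      ((∑ i, ∑ j, ((m i : ℂ) + (ε i : ℂ) / 2) * τ i j * ((m j : ℂ) + (ε j : ℂ) / 2)) +
        2 * ∑ i, ((m i : ℂ) + (ε i : ℂ) / 2) * (z i + (δ i : ℂ) / 2)))

/-- Partial derivative `∂_{z_i} f` evaluated at `z`. -/
def dz {g : ℕ} (f : (Fin g → ℂ) → ℂ) (i : Fin g) (z : Fin g → ℂ) : ℂ :=
  fderiv ℂ f z (Pi.single i 1)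

/-- Second partial derivative `∂_{z_i}∂_{z_j} f` evaluated at `z = 0`. -/
def D2 {g : ℕ} (f : (Fin g → ℂ) → ℂ) (i j : Fin g) : ℂ :=
  fderiv ℂ (fun z => fderiv ℂ f z (Pi.single j 1)) 0 (Pi.single i 1)

/-- `A^β_{ij,εδ}(τ) = ∂_{z_i}∂_{z_j}(θ[δ,β](2τ,2z))|₀ · θ[ε,β](2τ,0)
      − θ[δ,β](2τ,0) · ∂_{z_i}∂_{z_j}(θ[ε,β](2τ,2z))|₀`. -/
def Acoef {g : ℕ} (τ : Matrix (Fin g) (Fin g) ℂ) (i j : Fin g)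
    (ε δ β : Fin g → ℤ) : ℂ :=
  D2 (fun z => theta ((2 : ℂ) • τ) δ β (fun k => 2 * z k)) i j * theta ((2 : ℂ) • τ) ε β 0 -
    theta ((2 : ℂ) • τ) δ β 0 * D2 (fun z => theta ((2 : ℂ) • τ) ε β (fun k => 2 * z k)) i j

/-- `C^β_{ij,εδ}(τ) = ∂_{z_i}θ[ε,β+δ](τ,0)·∂_{z_j}θ[ε,δ](τ,0)
      + ∂_{z_j}θ[ε,β+δ](τ,0)·∂_{z_i}θ[ε,δ](τ,0)`. -/
def Ccoef {g : ℕ} (τ : Matrix (Fin g) (Fin g) ℂ) (i j : Fin g)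
    (ε δ β : Fin g → ℤ) : ℂ :=
  dz (theta τ ε (β + δ)) i 0 * dz (theta τ ε δ) j 0 +
    dz (theta τ ε (β + δ)) j 0 * dz (theta τ ε δ) i 0

/-- A positive definite real quadratic form dominates a multiple of the squared sup norm. -/
lemma Matrix.PosDef.exists_pos_mul_norm_sq_le {n : Type*} [Fintype n] {Y : Matrix n n ℝ}
    (hY : Y.PosDef) : ∃ c > 0, ∀ x : n → ℝ, c * ‖x‖ ^ 2 ≤ ∑ i, ∑ j, x i * Y i j * x j := by
  have hcont : Continuous fun x : n → ℝ => ∑ i, ∑ j, x i * Y i j * x j := by fun_prop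
  have hpos : ∀ x : n → ℝ, x ≠ 0 → 0 < ∑ i, ∑ j, x i * Y i j * x j := fun x hx => by
    simpa [dotProduct, Matrix.mulVec, Finset.mul_sum, mul_assoc] using hY.dotProduct_mulVec_pos hx
  rcases (Metric.sphere (0 : n → ℝ) 1).eq_empty_or_nonempty with h | h
  · refine ⟨1, one_pos, fun x => ?_⟩
    have hx : x = 0 := by
      by_contra hx
      have : ‖x‖⁻¹ • x ∈ Metric.sphere (0 : n → ℝ) 1 := by
        simp [norm_smul, norm_ne_zero_iff.mpr hx]
      simp [h] at this
    simp [hx]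
  · obtain ⟨y, hy, hmin⟩ := (isCompact_sphere (0 : n → ℝ) 1).exists_isMinOn h hcont.continuousOn
    have hy0 : y ≠ 0 := by
      rintro rfl
      simp at hy
    refine ⟨_, hpos y hy0, fun x => ?_⟩
    rcases eq_or_ne x 0 with rfl | hx
    · simp
    have hn : 0 < ‖x‖ := norm_pos_iff.mpr hx
    have hmem : ‖x‖⁻¹ • x ∈ Metric.sphere (0 : n → ℝ) 1 := by
      simp [norm_smul, norm_ne_zero_iff.mpr hx]
    have hle := hmin hmem
    have hscale : ∑ i, ∑ j, (‖x‖⁻¹ • x) i * Y i j * (‖x‖⁻¹ • x) j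
        = (‖x‖ ^ 2)⁻¹ * ∑ i, ∑ j, x i * Y i j * x j := by
      simp only [Finset.mul_sum, Pi.smul_apply, smul_eq_mul]
      refine Finset.sum_congr rfl fun i _ => Finset.sum_congr rfl fun j _ => ?_
      field_simp
    simp only [Set.mem_ofPred_eq, hscale] at hle
    rwa [inv_mul_eq_div, le_div_iff₀ (by positivity)] at hle

/-- A product of summable nonnegative functions of separate variables is summable. -/
lemma summable_prod_pi {ι : Type*} {f : ι → ℝ} (hf : Summable f) (h0 : 0 ≤ f) (n : ℕ) :
    Summable fun m : Fin n → ι => ∏ k, f (m k) := by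
  induction n with
  | zero => exact (hasSum_fintype _).summable
  | succ n ih =>
    rw [← (Fin.consEquiv fun _ => ι).summable_iff]
    refine (hf.mul_of_nonneg ih h0 fun m => Finset.prod_nonneg fun k _ => h0 _).congr fun x => ?_
    simp [Fin.consEquiv, Fin.prod_univ_succ]

lemma summable_exp_neg_abs_int : Summable fun n : ℤ => Real.exp (-|(n : ℝ)|) := by
  refine Summable.of_nat_of_neg ?_ ?_ <;>
  simpa using Real.summable_exp_neg_nat

/-- Gaussian sums over a shifted lattice converge, even with a linear exponential weight. -/
lemma summable_exp_neg_quadratic {g : ℕ} {Y : Matrix (Fin g) (Fin g) ℝ} (hY : Y.PosDef)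
    (e : Fin g → ℝ) (K : ℝ) :
    Summable fun m : Fin g → ℤ => Real.exp
      (-Real.pi * (∑ i, ∑ j, (m i + e i) * Y i j * (m j + e j)) + K * ∑ k, |m k + e k|) := by
  obtain ⟨c, hc, hle⟩ := hY.exists_pos_mul_norm_sq_le
  have hsum := (summable_prod_pi summable_exp_neg_abs_int (fun _ => (Real.exp_pos _).le) g).mul_left
    (Real.exp (((|K| + 1) * g) ^ 2 / (4 * (Real.pi * c)) + ∑ k, |e k|))
  refine hsum.of_nonneg_of_le (fun _ => (Real.exp_pos _).le) fun m => ?_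
  rw [← Real.exp_sum, ← Real.exp_add]
  refine Real.exp_le_exp.mpr ?_
  have hc' : 0 < Real.pi * c := mul_pos Real.pi_pos hc
  set x : Fin g → ℝ := fun k => m k + e k with hx
  have h1 : Real.pi * c * ‖x‖ ^ 2 ≤ Real.pi * ∑ i, ∑ j, (m i + e i) * Y i j * (m j + e j) := by
    rw [mul_assoc]
    exact mul_le_mul_of_nonneg_left (hle x) Real.pi_pos.le
  have h2 : ∑ k, |x k| ≤ g * ‖x‖ := by
    simpa using Finset.sum_le_card_nsmul Finset.univ (fun k => |x k|) ‖x‖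
      fun k _ => norm_le_pi_norm x k
  have h3 : ∑ k, |(m k : ℝ)| ≤ ∑ k, |x k| + ∑ k, |e k| := by
    rw [← Finset.sum_add_distrib]
    refine Finset.sum_le_sum fun k _ => ?_
    simpa [hx] using abs_sub (x k) (e k)
  have h4 : K * ∑ k, |x k| ≤ |K| * ∑ k, |x k| :=
    mul_le_mul_of_nonneg_right (le_abs_self K) (Finset.sum_nonneg fun _ _ => abs_nonneg _)
  have h5 : (|K| + 1) * ∑ k, |x k| ≤ (|K| + 1) * (g * ‖x‖) :=
    mul_le_mul_of_nonneg_left h2 (by positivity)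
  have h6 : (|K| + 1) * (g * ‖x‖) - Real.pi * c * ‖x‖ ^ 2
      ≤ ((|K| + 1) * g) ^ 2 / (4 * (Real.pi * c)) := by
    rw [le_div_iff₀ (by positivity)]
    nlinarith [sq_nonneg ((|K| + 1) * g - 2 * (Real.pi * c) * ‖x‖)]
  rw [Finset.sum_neg_distrib]
  linarith

section ExpSeries

variable {ι E : Type*} [NormedAddCommGroup E] [NormedSpace ℂ E] {c : ι → ℂ} {L : ι → E →L[ℂ] ℂ}

lemma norm_cexp_apply_le (ℓ : E →L[ℂ] ℂ) (z : E) {R : ℝ} (hz : ‖z‖ ≤ R) :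
    ‖cexp (ℓ z)‖ ≤ Real.exp (R * ‖ℓ‖) := by
  rw [Complex.norm_exp]
  refine Real.exp_le_exp.mpr ((Complex.re_le_norm _).trans ((ℓ.le_opNorm z).trans ?_))
  rw [mul_comm]
  exact mul_le_mul_of_nonneg_right hz (norm_nonneg _)

/-- Rapid decay of the coefficients is preserved by multiplying them by the frequencies. -/
lemma summable_mul_apply (h : ∀ R : ℝ, Summable fun m => ‖c m‖ * Real.exp (R * ‖L m‖)) (v : E)
    (R : ℝ) : Summable fun m => ‖c m * L m v‖ * Real.exp (R * ‖L m‖) := by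
  refine ((h (R + 1)).mul_left ‖v‖).of_nonneg_of_le (fun m => by positivity) fun m => ?_
  have h1 : ‖L m‖ ≤ Real.exp ‖L m‖ := by linarith [Real.add_one_le_exp ‖L m‖]
  have h2 := (L m).le_opNorm v
  rw [norm_mul, add_mul, one_mul, Real.exp_add]
  calc ‖c m‖ * ‖L m v‖ * Real.exp (R * ‖L m‖)
      ≤ ‖c m‖ * (Real.exp ‖L m‖ * ‖v‖) * Real.exp (R * ‖L m‖) := by
        gcongr
        exact h2.trans (by gcongr)
    _ = _ := by ring

/-- Termwise differentiation of a series of exponentials with rapidly decaying coefficients. -/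
lemma fderiv_tsum_mul_cexp (h : ∀ R : ℝ, Summable fun m => ‖c m‖ * Real.exp (R * ‖L m‖))
    (z v : E) :
    fderiv ℂ (fun z => ∑' m, c m * cexp (L m z)) z v = ∑' m, c m * L m v * cexp (L m z) := by
  have hterm : ∀ m y, HasFDerivAt (fun y => c m * cexp (L m y))
      (c m • cexp (L m y) • L m) y := fun m y => (L m).hasFDerivAt.cexp.const_mul (c m)
  have hbound : ∀ R, Summable fun m => ‖c m‖ * Real.exp (R * ‖L m‖) * ‖L m‖ := fun R => by
    refine (h (R + 1)).of_nonneg_of_le (fun m => by positivity) fun m => ?_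
    rw [add_mul, one_mul, Real.exp_add, ← mul_assoc]
    gcongr
    linarith [Real.add_one_le_exp ‖L m‖]
  have hle : ∀ m, ∀ y ∈ Metric.ball (0 : E) (‖z‖ + 1), ‖c m • cexp (L m y) • L m‖ ≤
      ‖c m‖ * Real.exp ((‖z‖ + 1) * ‖L m‖) * ‖L m‖ := fun m y hy => by
    rw [norm_smul, norm_smul, ← mul_assoc]
    gcongr
    exact norm_cexp_apply_le _ _ (mem_ball_zero_iff.mp hy).le
  have hz : z ∈ Metric.ball (0 : E) (‖z‖ + 1) := by simp
  let _ : NormedSpace ℝ E := NormedSpace.restrictScalars ℝ ℂ E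
  have hderiv := hasFDerivAt_tsum_of_isPreconnected (hbound (‖z‖ + 1)) Metric.isOpen_ball
    (convex_ball (0 : E) _).isPreconnected (fun m y _ => hterm m y) hle
    (Metric.mem_ball_self (by positivity))
    (.of_norm (by simpa using h 0)) hz
  rw [hderiv.fderiv]
  have hsum : Summable fun m => c m • cexp (L m z) • L m :=
    .of_norm_bounded (hbound (‖z‖ + 1)) fun m => hle m z hz
  have := (ContinuousLinearMap.apply ℂ ℂ v).map_tsum hsum
  rw [ContinuousLinearMap.apply_apply] at this
  rw [this]
  refine tsum_congr fun m => ?_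
  simp [mul_comm, mul_left_comm]

end ExpSeries

section Theta

variable {g : ℕ}

/-- The point `m + ε/2` of the shifted lattice. -/
def latticePoint (ε m : Fin g → ℤ) (k : Fin g) : ℂ := (m k : ℂ) + (ε k : ℂ) / 2

/-- The coefficient of `exp(2πi(m+ε/2)·z)` in the series of `θ[ε,δ](τ,z)`. -/
def thetaCoeff (τ : Matrix (Fin g) (Fin g) ℂ) (ε δ m : Fin g → ℤ) : ℂ :=
  cexp (↑Real.pi * I * ((∑ i, ∑ j, latticePoint ε m i * τ i j * latticePoint ε m j) +
    ∑ k, latticePoint ε m k * (δ k : ℂ)))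

/-- The linear form `z ↦ 2πi(m+ε/2)·(sz)`. -/
def thetaFreq (s : ℂ) (ε m : Fin g → ℤ) : (Fin g → ℂ) →L[ℂ] ℂ :=
  ∑ k, (2 * ↑Real.pi * I * s * latticePoint ε m k) •
    (ContinuousLinearMap.proj k : (Fin g → ℂ) →L[ℂ] ℂ)

lemma thetaFreq_apply (s : ℂ) (ε m : Fin g → ℤ) (z : Fin g → ℂ) :
    thetaFreq s ε m z = ∑ k, 2 * ↑Real.pi * I * s * latticePoint ε m k * z k := by
  simp [thetaFreq]

lemma thetaFreq_single (s : ℂ) (ε m : Fin g → ℤ) (i : Fin g) :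
    thetaFreq s ε m (Pi.single i 1) = 2 * ↑Real.pi * I * s * latticePoint ε m i := by
  simp [thetaFreq_apply, Pi.single_apply]

lemma theta_mul_eq_tsum (τ : Matrix (Fin g) (Fin g) ℂ) (ε δ : Fin g → ℤ) (s : ℂ)
    (z : Fin g → ℂ) : theta τ ε δ (fun k => s * z k) =
      ∑' m, thetaCoeff τ ε δ m * cexp (thetaFreq s ε m z) := by
  refine tsum_congr fun m => ?_
  have hlin : ↑Real.pi * I * (2 * ∑ k, latticePoint ε m k * (s * z k + (δ k : ℂ) / 2)) =
      ↑Real.pi * I * ∑ k, latticePoint ε m k * (δ k : ℂ) +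
        ∑ k, 2 * ↑Real.pi * I * s * latticePoint ε m k * z k := by
    simp only [Finset.mul_sum, ← Finset.sum_add_distrib]
    refine Finset.sum_congr rfl fun k _ => ?_
    ring
  rw [thetaCoeff, ← Complex.exp_add, thetaFreq_apply, mul_add, mul_add, add_assoc, ← hlin]
  rfl

lemma theta_zero_eq_tsum (τ : Matrix (Fin g) (Fin g) ℂ) (ε δ : Fin g → ℤ) :
    theta τ ε δ 0 = ∑' m, thetaCoeff τ ε δ m := by
  simpa [← Pi.zero_def] using theta_mul_eq_tsum τ ε δ 1 0

lemma norm_thetaCoeff (τ : Matrix (Fin g) (Fin g) ℂ) (ε δ m : Fin g → ℤ) :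
    ‖thetaCoeff τ ε δ m‖ = Real.exp (-Real.pi *
      ∑ i, ∑ j, ((m i : ℝ) + (ε i : ℝ) / 2) * (τ i j).im * ((m j : ℝ) + (ε j : ℝ) / 2)) := by
  have hp : ∀ k, latticePoint ε m k = (((m k : ℝ) + (ε k : ℝ) / 2 : ℝ) : ℂ) := fun k => by
    simp [latticePoint]
  have hδ : ∀ k, (δ k : ℂ) = ((δ k : ℝ) : ℂ) := fun k => by simp
  have hre : ∀ w : ℂ, (↑Real.pi * I * w).re = -Real.pi * w.im := fun w => by simp
  rw [thetaCoeff, Complex.norm_exp, hre]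
  simp only [hp, hδ, Complex.add_im, Complex.im_sum, ← Complex.ofReal_mul, Complex.ofReal_im,
    Finset.sum_const_zero, add_zero, Complex.im_mul_ofReal, Complex.im_ofReal_mul]

lemma norm_thetaFreq_le (s : ℂ) (ε m : Fin g → ℤ) :
    ‖thetaFreq s ε m‖ ≤ 2 * Real.pi * ‖s‖ * ∑ k, |(m k : ℝ) + (ε k : ℝ) / 2| := by
  rw [thetaFreq, Finset.mul_sum]
  refine norm_sum_le_of_le Finset.univ fun k _ => ?_
  have hp : ‖latticePoint ε m k‖ = |(m k : ℝ) + (ε k : ℝ) / 2| := by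
    rw [← Real.norm_eq_abs, ← Complex.norm_real]
    simp [latticePoint]
  have hproj : ‖(ContinuousLinearMap.proj k : (Fin g → ℂ) →L[ℂ] ℂ)‖ ≤ 1 :=
    ContinuousLinearMap.opNorm_le_bound _ zero_le_one fun z => by
      simpa using norm_le_pi_norm z k
  rw [norm_smul, norm_mul, hp]
  refine (mul_le_of_le_one_right (by positivity) hproj).trans (le_of_eq ?_)
  simp [abs_of_pos Real.pi_pos]

lemma summable_thetaCoeff {τ : Matrix (Fin g) (Fin g) ℂ} (hτ : IsSiegel τ) (ε δ : Fin g → ℤ)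
    (s : ℂ) (R : ℝ) :
    Summable fun m => ‖thetaCoeff τ ε δ m‖ * Real.exp (R * ‖thetaFreq s ε m‖) := by
  refine (summable_exp_neg_quadratic hτ.2 (fun k => (ε k : ℝ) / 2)
    (|R| * (2 * Real.pi * ‖s‖))).of_nonneg_of_le (fun m => by positivity) fun m => ?_
  rw [norm_thetaCoeff, ← Real.exp_add]
  refine Real.exp_le_exp.mpr (add_le_add le_rfl ?_)
  rw [mul_assoc |R|]
  exact mul_le_mul (le_abs_self R) (norm_thetaFreq_le s ε m) (norm_nonneg _) (abs_nonneg R)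

lemma summable_norm_thetaCoeff {τ : Matrix (Fin g) (Fin g) ℂ} (hτ : IsSiegel τ)
    (ε δ : Fin g → ℤ) : Summable fun m => ‖thetaCoeff τ ε δ m‖ := by
  simpa using summable_thetaCoeff hτ ε δ 1 0

lemma summable_norm_thetaCoeff_mul {τ : Matrix (Fin g) (Fin g) ℂ} (hτ : IsSiegel τ)
    (ε δ : Fin g → ℤ) (s : ℂ) (i : Fin g) :
    Summable fun m => ‖thetaCoeff τ ε δ m * (2 * ↑Real.pi * I * s * latticePoint ε m i)‖ := by
  simpa only [zero_mul, Real.exp_zero, mul_one, thetaFreq_single] using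
    summable_mul_apply (summable_thetaCoeff hτ ε δ s) (Pi.single i 1) 0

lemma summable_norm_thetaCoeff_mul_mul {τ : Matrix (Fin g) (Fin g) ℂ} (hτ : IsSiegel τ)
    (ε δ : Fin g → ℤ) (s : ℂ) (i j : Fin g) :
    Summable fun m => ‖thetaCoeff τ ε δ m * (2 * ↑Real.pi * I * s * latticePoint ε m j) *
      (2 * ↑Real.pi * I * s * latticePoint ε m i)‖ := by
  simpa only [zero_mul, Real.exp_zero, mul_one, thetaFreq_single] using
    summable_mul_apply (summable_mul_apply (summable_thetaCoeff hτ ε δ s) (Pi.single j 1))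
      (Pi.single i 1) 0

lemma dz_theta_zero {τ : Matrix (Fin g) (Fin g) ℂ} (hτ : IsSiegel τ) (ε δ : Fin g → ℤ)
    (i : Fin g) : dz (theta τ ε δ) i 0 =
      ∑' m, thetaCoeff τ ε δ m * (2 * ↑Real.pi * I * 1 * latticePoint ε m i) := by
  have h : theta τ ε δ = fun z => ∑' m, thetaCoeff τ ε δ m * cexp (thetaFreq 1 ε m z) :=
    funext fun z => by simpa using theta_mul_eq_tsum τ ε δ 1 z
  rw [dz, h, fderiv_tsum_mul_cexp (summable_thetaCoeff hτ ε δ 1)]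
  simp only [thetaFreq_single, map_zero, Complex.exp_zero, mul_one]

lemma D2_theta_mul {τ : Matrix (Fin g) (Fin g) ℂ} (hτ : IsSiegel τ) (ε δ : Fin g → ℤ) (s : ℂ)
    (i j : Fin g) : D2 (fun z => theta τ ε δ (fun k => s * z k)) i j =
      ∑' m, thetaCoeff τ ε δ m * (2 * ↑Real.pi * I * s * latticePoint ε m j) *
        (2 * ↑Real.pi * I * s * latticePoint ε m i) := by
  simp only [D2, theta_mul_eq_tsum, fderiv_tsum_mul_cexp (summable_thetaCoeff hτ ε δ s)]
  rw [fderiv_tsum_mul_cexp (summable_mul_apply (summable_thetaCoeff hτ ε δ s) (Pi.single j 1))]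
  simp only [thetaFreq_single, map_zero, Complex.exp_zero, mul_one]

lemma IsSiegel.two_smul {τ : Matrix (Fin g) (Fin g) ℂ} (hτ : IsSiegel τ) :
    IsSiegel ((2 : ℂ) • τ) := by
  refine ⟨hτ.1.smul 2, ?_⟩
  convert hτ.2.smul (two_pos : (0 : ℝ) < 2) using 1
  ext i j
  simp

/-- Pairs of lattice vectors `(m, n)` are uniquely `(A + B + α, A - B)` with `α ∈ {0,1}^g`. -/
lemma bijective_add_sub : Function.Bijective
    fun x : (Fin g → Fin 2) × (Fin g → ℤ) × (Fin g → ℤ) =>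
      ((fun k => x.2.1 k + x.2.2 k + ((x.1 k : ℕ) : ℤ), fun k => x.2.1 k - x.2.2 k) :
        (Fin g → ℤ) × (Fin g → ℤ)) := by
  constructor
  · rintro ⟨α, A, B⟩ ⟨α', A', B'⟩ h
    simp only [Prod.mk.injEq, funext_iff] at h
    obtain ⟨h1, h2⟩ := h
    simp only [Prod.mk.injEq, funext_iff, Fin.ext_iff]
    refine ⟨fun k => ?_, fun k => ?_, fun k => ?_⟩ <;>
    · have := h1 k
      have := h2 k
      have := (α k).isLt
      have := (α' k).isLt
      omega
  · rintro ⟨m, n⟩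
    refine ⟨⟨fun k => ⟨((m k + n k) % 2).toNat, by omega⟩, fun k => (m k + n k) / 2,
      fun k => (m k + n k) / 2 - n k⟩, ?_⟩
    simp only [Prod.mk.injEq, funext_iff]
    exact ⟨fun k => by omega, fun k => by omega⟩

lemma thetaCoeff_mul_thetaCoeff (τ : Matrix (Fin g) (Fin g) ℂ) (ε δ β α A B : Fin g → ℤ)
    (hodd : Odd (∑ k, ε k * δ k)) :
    thetaCoeff τ ε (β + δ) (fun k => A k + B k + α k) * thetaCoeff τ ε δ (fun k => A k - B k) =
      -(-1) ^ (∑ k, α k * δ k) *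
        (thetaCoeff ((2 : ℂ) • τ) (ε + α) β A * thetaCoeff ((2 : ℂ) • τ) α β B) := by
  have hsign : -(-1 : ℂ) ^ (∑ k, α k * δ k) =
      cexp ((∑ k, (2 * A k + ε k + α k) * δ k : ℤ) * (↑Real.pi * I)) := by
    rw [Complex.exp_int_mul, Complex.exp_pi_mul_I]
    have : ∑ k, (2 * A k + ε k + α k) * δ k =
        2 * ∑ k, A k * δ k + ∑ k, ε k * δ k + ∑ k, α k * δ k := by
      simp only [Finset.mul_sum, ← Finset.sum_add_distrib]
      exact Finset.sum_congr rfl fun k _ => by ring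
    rw [this, zpow_add₀ (by norm_num), zpow_add₀ (by norm_num), hodd.neg_one_zpow,
      (even_two_mul _).neg_one_zpow]
    ring
  rw [hsign]
  simp only [thetaCoeff, ← Complex.exp_add]
  congr 1
  push_cast
  rw [mul_comm _ (↑Real.pi * I : ℂ), ← mul_add, ← mul_add, ← mul_add]
  congr 1
  have hquad : ∀ i j, latticePoint ε (fun k => A k + B k + α k) i * τ i j *
        latticePoint ε (fun k => A k + B k + α k) j +
      latticePoint ε (fun k => A k - B k) i * τ i j * latticePoint ε (fun k => A k - B k) j =
      latticePoint (ε + α) A i * ((2 : ℂ) • τ) i j * latticePoint (ε + α) A j +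
        latticePoint α B i * ((2 : ℂ) • τ) i j * latticePoint α B j := fun i j => by
    simp only [latticePoint, Pi.add_apply, Matrix.smul_apply, smul_eq_mul]
    push_cast
    ring
  have hlin : ∀ k, latticePoint ε (fun k => A k + B k + α k) k * (((β + δ) k : ℤ) : ℂ) +
      latticePoint ε (fun k => A k - B k) k * (δ k : ℂ) =
      (2 * (A k : ℂ) + ε k + α k) * δ k + (latticePoint (ε + α) A k * (β k : ℂ) +
        latticePoint α B k * (β k : ℂ)) := fun k => by
    simp only [latticePoint, Pi.add_apply]
    push_cast
    ring
  have hQ := Finset.sum_congr rfl fun i (_ : i ∈ Finset.univ) =>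
    Finset.sum_congr rfl fun j (_ : j ∈ Finset.univ) => hquad i j
  have hL := Finset.sum_congr rfl fun k (_ : k ∈ Finset.univ) => hlin k
  simp only [Finset.sum_add_distrib] at hQ hL
  linear_combination hQ + hL

lemma hasSum_Ccoef {τ : Matrix (Fin g) (Fin g) ℂ} (hτ : IsSiegel τ) (i j : Fin g)
    (ε δ β : Fin g → ℤ) :
    HasSum (fun x : (Fin g → ℤ) × (Fin g → ℤ) =>
      thetaCoeff τ ε (β + δ) x.1 * thetaCoeff τ ε δ x.2 * (2 * ↑Real.pi * I) ^ 2 *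
        (latticePoint ε x.1 i * latticePoint ε x.2 j +
          latticePoint ε x.1 j * latticePoint ε x.2 i)) (Ccoef τ i j ε δ β) := by
  have h := fun k => summable_norm_thetaCoeff_mul hτ ε (β + δ) 1 k
  have h' := fun k => summable_norm_thetaCoeff_mul hτ ε δ 1 k
  simp only [Ccoef, dz_theta_zero hτ, tsum_mul_tsum_of_summable_norm (h _) (h' _)]
  refine HasSum.congr_fun ((summable_mul_of_summable_norm (h i) (h' j)).hasSum.add
    (summable_mul_of_summable_norm (h j) (h' i)).hasSum)
    fun x => ?_
  ring

lemma hasSum_Acoef {τ : Matrix (Fin g) (Fin g) ℂ} (hτ : IsSiegel τ) (i j : Fin g)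
    (ε δ β : Fin g → ℤ) :
    HasSum (fun x : (Fin g → ℤ) × (Fin g → ℤ) =>
      thetaCoeff ((2 : ℂ) • τ) ε β x.1 * thetaCoeff ((2 : ℂ) • τ) δ β x.2 *
        (4 * ↑Real.pi * I) ^ 2 *
        (latticePoint δ x.2 i * latticePoint δ x.2 j -
          latticePoint ε x.1 i * latticePoint ε x.1 j)) (Acoef τ i j ε δ β) := by
  have h := fun ε => summable_norm_thetaCoeff hτ.two_smul ε β
  have h' := fun ε => summable_norm_thetaCoeff_mul_mul hτ.two_smul ε β 2 i j
  rw [Acoef, D2_theta_mul hτ.two_smul, D2_theta_mul hτ.two_smul, theta_zero_eq_tsum,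
    theta_zero_eq_tsum, mul_comm (∑' m, _ * _ * _), mul_comm (∑' m, thetaCoeff _ δ β m),
    tsum_mul_tsum_of_summable_norm (h _) (h' _), tsum_mul_tsum_of_summable_norm (h' _) (h _)]
  refine HasSum.congr_fun ((summable_mul_of_summable_norm (h ε) (h' δ)).hasSum.sub
    (summable_mul_of_summable_norm (h' ε) (h δ)).hasSum)
    fun x => ?_
  ring

end Theta

theorem statement0 {g : ℕ} (hg : 1 ≤ g) (τ : Matrix (Fin g) (Fin g) ℂ)
    (hτ : IsSiegel τ) (i j : Fin g) (ε δ β : Fin g → ℤ)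
    (hε : ∀ k, ε k = 0 ∨ ε k = 1) (hδ : ∀ k, δ k = 0 ∨ δ k = 1)
    (hβ : ∀ k, β k = 0 ∨ β k = 1)
    (hodd₁ : Odd (∑ k, ε k * δ k)) (hodd₂ : Odd (∑ k, ε k * (β k + δ k))) :
    Ccoef τ i j ε δ β =
      (1 / 2) * ∑ α : Fin g → Fin 2,
        (-1 : ℂ) ^ (∑ k, ((α k : ℕ) : ℤ) * δ k) *
          Acoef τ i j (ε + fun k => ((α k : ℕ) : ℤ)) (fun k => ((α k : ℕ) : ℤ)) β := by
  have hC := (Equiv.ofBijective _ bijective_add_sub).hasSum_iff.mpr (hasSum_Ccoef hτ i j ε δ β)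
  rw [Finset.mul_sum]
  refine HasSum.unique (hC.prod_fiberwise fun α => ?_) (hasSum_fintype _)
  refine HasSum.congr_fun (((hasSum_Acoef hτ i j (ε + fun k => ((α k : ℕ) : ℤ))
    (fun k => ((α k : ℕ) : ℤ)) β).mul_left
      ((-1 : ℂ) ^ (∑ k, ((α k : ℕ) : ℤ) * δ k))).mul_left (1 / 2))
    fun x => ?_
  simp only [Function.comp_apply, Equiv.ofBijective_apply]
  rw [thetaCoeff_mul_thetaCoeff τ ε δ β (fun k => ((α k : ℕ) : ℤ)) x.1 x.2 hodd₁]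
  simp only [latticePoint, Pi.add_apply]
  push_cast
  ring
end
end

section
/- Let g ≥ 1, let τ be a complex symmetric g×g matrix whose imaginary part is positive definite, let ε, δ ∈ ℤ^g, and let z ∈ ℂ^g. Then the family indexed by m ∈ ℤ^g with terms exp(πi((m+ε/2)ᵀτ(m+ε/2) + 2(m+ε/2)·(z+δ/2))) is summable (the theta series converges absolutely). -/
open scoped BigOperators
open Complex

noncomputable section

/-- A product of summable nonnegative families, one per coordinate, is summable over tuples. -/
lemma summable_pi_prod_of_nonneg {n : ℕ} {α : Type*} (f : Fin n → α → ℝ)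
    (hf₀ : ∀ i a, 0 ≤ f i a) (hf : ∀ i, Summable (f i)) :
    Summable fun m : Fin n → α => ∏ i, f i (m i) := by
  induction n with
  | zero => exact Summable.of_finite
  | succ n ih =>
    rw [← (Fin.consEquiv fun _ => α).summable_iff]
    have h := (hf 0).mul_of_nonneg (ih (fun i => f i.succ) (fun i => hf₀ i.succ) fun i => hf i.succ)
      (hf₀ 0) fun m => Finset.prod_nonneg fun i _ => hf₀ i.succ (m i)
    refine h.congr fun p => ?_
    simp [Fin.prod_univ_succ, Fin.consEquiv]

/-- A real positive definite quadratic form dominates a positive multiple of the sum of squares. -/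
lemma Matrix.PosDef.exists_pos_mul_sum_sq_le {ι : Type*} [Fintype ι] {Y : Matrix ι ι ℝ}
    (hY : Y.PosDef) :
    ∃ c > 0, ∀ x : ι → ℝ, c * ∑ i, x i ^ 2 ≤ ∑ i, ∑ j, x i * Y i j * x j := by
  have hpos : ∀ x : EuclideanSpace ℝ ι, x ≠ 0 → 0 < ∑ i, ∑ j, x i * Y i j * x j := by
    intro x hx
    have h := hY.re_dotProduct_pos (x := x.ofLp) (by simpa using hx)
    simpa [dotProduct, Matrix.mulVec, Finset.mul_sum, mul_assoc] using h
  obtain ⟨c, hc, hle⟩ := (isCompact_sphere (0 : EuclideanSpace ℝ ι) 1).exists_forall_le'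
    (f := fun x => ∑ i, ∑ j, x i * Y i j * x j) (by fun_prop) (a := 0)
    fun x hx => hpos x (ne_zero_of_mem_unit_sphere ⟨x, hx⟩)
  refine ⟨c, hc, fun x => ?_⟩
  by_cases hx : x = 0
  · simp [hx]
  set v : EuclideanSpace ℝ ι := WithLp.toLp 2 x with hv
  have hv₀ : 0 < ‖v‖ := norm_pos_iff.2 (by simpa [hv] using hx)
  have hsq : ∑ i, x i ^ 2 = ‖v‖ ^ 2 := by simp [EuclideanSpace.real_norm_sq_eq, hv]
  have h := hle (‖v‖⁻¹ • v) (by simp [norm_smul, hv₀.ne'])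
  have hscale : ∑ i, ∑ j, (‖v‖⁻¹ • v) i * Y i j * (‖v‖⁻¹ • v) j =
      (‖v‖ ^ 2)⁻¹ * ∑ i, ∑ j, x i * Y i j * x j := by
    simp only [Finset.mul_sum, PiLp.smul_apply, smul_eq_mul, hv]
    refine Finset.sum_congr rfl fun i _ => Finset.sum_congr rfl fun j _ => ?_
    ring
  rw [hscale, ← div_eq_inv_mul, le_div_iff₀ (by positivity)] at h
  rwa [hsq]

/-- Shifted one-dimensional Gaussian sums with a linear term in the exponent converge. -/
lemma summable_int_exp_neg_quadratic {c : ℝ} (hc : 0 < c) (a y : ℝ) :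
    Summable fun m : ℤ => Real.exp (-Real.pi * (c * (m + a) ^ 2 + 2 * ((m + a) * y))) := by
  have h := ((summable_jacobiTheta₂_term_iff ((c * a + y : ℝ) * I) (c * I)).2
    (by simpa using hc)).norm.mul_left (Real.exp (-Real.pi * (c * a ^ 2 + 2 * (a * y))))
  refine h.congr fun m => ?_
  rw [norm_jacobiTheta₂_term, ← Real.exp_add]
  congr 1
  simp only [im_ofReal_mul, I_im]
  ring

theorem statement13 {g : ℕ} (hg : 1 ≤ g) (τ : Matrix (Fin g) (Fin g) ℂ)
    (hτ : IsSiegel τ) (ε δ : Fin g → ℤ) (z : Fin g → ℂ) :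
    Summable fun m : Fin g → ℤ =>
      Complex.exp (↑Real.pi * Complex.I *
        ((∑ i, ∑ j, ((m i : ℂ) + (ε i : ℂ) / 2) * τ i j * ((m j : ℂ) + (ε j : ℂ) / 2)) +
          2 * ∑ i, ((m i : ℂ) + (ε i : ℂ) / 2) * (z i + (δ i : ℂ) / 2))) := by
  obtain ⟨c, hc, hle⟩ := hτ.2.exists_pos_mul_sum_sq_le
  refine Summable.of_norm_bounded (summable_pi_prod_of_nonneg
    (fun i (k : ℤ) => Real.exp (-Real.pi *
      (c * (k + (ε i / 2 : ℝ)) ^ 2 + 2 * ((k + (ε i / 2 : ℝ)) * (z i).im))))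
    (fun _ _ => (Real.exp_pos _).le)
    fun i => summable_int_exp_neg_quadratic hc (ε i / 2) (z i).im) fun m => ?_
  have hx : ∀ i, (m i : ℂ) + (ε i : ℂ) / 2 = ((m i + ε i / 2 : ℝ) : ℂ) := fun i => by push_cast; rfl
  have hδ : ∀ i, (z i + (δ i : ℂ) / 2).im = (z i).im := fun i => by
    have : (δ i : ℂ) / 2 = ((δ i / 2 : ℝ) : ℂ) := by push_cast; rfl
    rw [this, add_im, ofReal_im, add_zero]
  have hre : ∀ w : ℂ, (↑Real.pi * I * w).re = -Real.pi * w.im := fun w => by simp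
  have h2 : ∀ w : ℂ, (2 * w).im = 2 * w.im := fun w => by simp
  rw [norm_exp, ← Real.exp_sum, Real.exp_le_exp, ← Finset.mul_sum, Finset.sum_add_distrib,
    ← Finset.mul_sum, ← Finset.mul_sum, hre]
  refine mul_le_mul_of_nonpos_left ?_ (neg_nonpos.2 Real.pi_pos.le)
  simp only [hx, add_im, h2, im_sum, im_ofReal_mul, im_mul_ofReal, hδ]
  exact add_le_add_left (hle fun i => m i + ε i / 2) _
end
end

section
/- Let g ≥ 1 and let n be a positive even integer. Then the set Γ_g(n,2n) := { γ = (a b; c d) ∈ Sp(2g,ℤ) : γ ≡ I mod n, diag(aᵀb) ≡ 0 mod 2n, and diag(cᵀd) ≡ 0 mod 2n } is a subgroup of Sp(2g,ℤ): it contains the identity, and is closed under products and inverses. -/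
open scoped Matrix

noncomputable section

/-- The standard symplectic form matrix `J = (0 I; −I 0)` in `g × g` blocks. -/
def Jmat (g : ℕ) : Matrix (Fin g ⊕ Fin g) (Fin g ⊕ Fin g) ℤ :=
  Matrix.fromBlocks 0 1 (-1) 0

/-- The integral symplectic group `Sp(2g,ℤ)`, as a set of matrices. -/
def Sp (g : ℕ) : Set (Matrix (Fin g ⊕ Fin g) (Fin g ⊕ Fin g) ℤ) :=
  {γ | γᵀ * Jmat g * γ = Jmat g}

/-- The principal congruence condition `γ ≡ I mod n`. -/
def CongrOne (g : ℕ) (γ : Matrix (Fin g ⊕ Fin g) (Fin g ⊕ Fin g) ℤ) (n : ℕ) : Prop :=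
  ∀ i j, (n : ℤ) ∣ (γ i j - (1 : Matrix (Fin g ⊕ Fin g) (Fin g ⊕ Fin g) ℤ) i j)

/-- The condition `diag(aᵀb) ≡ diag(cᵀd) ≡ 0 mod m` on the blocks of
`γ = (a b; c d)`. -/
def DiagCond (g : ℕ) (γ : Matrix (Fin g ⊕ Fin g) (Fin g ⊕ Fin g) ℤ) (m : ℕ) : Prop :=
  (∀ i, (m : ℤ) ∣ ((γ.toBlocks₁₁)ᵀ * γ.toBlocks₁₂) i i) ∧
    (∀ i, (m : ℤ) ∣ ((γ.toBlocks₂₁)ᵀ * γ.toBlocks₂₂) i i)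

/-- The level subgroup `Γ_g(n,2n)` as a set of matrices. -/
def GammaSet (g n : ℕ) : Set (Matrix (Fin g ⊕ Fin g) (Fin g ⊕ Fin g) ℤ) :=
  {γ ∈ Sp g | CongrOne g γ n ∧ DiagCond g γ (2 * n)}

theorem Jmat_eq_neg_J (g : ℕ) : Jmat g = -Matrix.J (Fin g) ℤ := by
  simp [Jmat, Matrix.J, Matrix.fromBlocks_neg]

theorem mem_Sp_iff {g : ℕ} {γ : Matrix (Fin g ⊕ Fin g) (Fin g ⊕ Fin g) ℤ} :
    γ ∈ Sp g ↔ γ ∈ Matrix.symplecticGroup (Fin g) ℤ := by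
  rw [SymplecticGroup.mem_iff']
  simp [Sp, Jmat_eq_neg_J]

/-- The inverse of a symplectic matrix `(a b; c d)` is `(dᵀ −bᵀ; −cᵀ aᵀ)`. -/
theorem inv_eq_fromBlocks {g : ℕ} {γ : Matrix (Fin g ⊕ Fin g) (Fin g ⊕ Fin g) ℤ}
    (h : γ ∈ Sp g) :
    γ⁻¹ = Matrix.fromBlocks γ.toBlocks₂₂ᵀ (-γ.toBlocks₁₂ᵀ) (-γ.toBlocks₂₁ᵀ) γ.toBlocks₁₁ᵀ := by
  rw [SymplecticGroup.inv_eq_symplectic_inv γ (mem_Sp_iff.1 h)]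
  conv_lhs => rw [← Matrix.fromBlocks_toBlocks γ]
  simp [Matrix.J, Matrix.fromBlocks_transpose, Matrix.fromBlocks_multiply, Matrix.fromBlocks_neg]

theorem inv_mem_Sp {g : ℕ} {γ : Matrix (Fin g ⊕ Fin g) (Fin g ⊕ Fin g) ℤ} (h : γ ∈ Sp g) :
    γ⁻¹ ∈ Sp g := by
  have hγ := mem_Sp_iff.1 h
  have h_inv := (⟨γ, hγ⟩ : Matrix.symplecticGroup (Fin g) ℤ)⁻¹.2
  rw [SymplecticGroup.coe_inv'] at h_inv
  exact mem_Sp_iff.2 h_inv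

theorem mul_self_dvd_mul_apply {l m o : Type*} [Fintype m] {k : ℤ} {X : Matrix l m ℤ}
    {Y : Matrix m o ℤ} (hX : ∀ i j, k ∣ X i j) (hY : ∀ i j, k ∣ Y i j) (i : l) (j : o) :
    k * k ∣ (X * Y) i j :=
  Finset.dvd_sum fun x _ => mul_dvd_mul (hX i x) (hY x j)

theorem mul_sub_one_dvd {g n : ℕ} {γ₁ γ₂ : Matrix (Fin g ⊕ Fin g) (Fin g ⊕ Fin g) ℤ}
    (h₁ : CongrOne g γ₁ n) (h₂ : CongrOne g γ₂ n) (i j : Fin g ⊕ Fin g) :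
    (n * n : ℤ) ∣ ((γ₁ * γ₂ - 1) - (γ₁ - 1) - (γ₂ - 1)) i j := by
  have h : (γ₁ * γ₂ - 1) - (γ₁ - 1) - (γ₂ - 1) = (γ₁ - 1) * (γ₂ - 1) := by noncomm_ring
  rw [h]
  exact mul_self_dvd_mul_apply h₁ h₂ i j

theorem two_mul_dvd_mul_self {n : ℕ} (hn : Even n) : ((2 * n : ℕ) : ℤ) ∣ n * n := by
  push_cast
  exact mul_dvd_mul_right (by exact_mod_cast hn.two_dvd) _

/-- For even `n` and `γ ≡ I mod n`, the condition on `diag(aᵀb)` and `diag(cᵀd)` only depends on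
`diag(b)` and `diag(c)`. -/
theorem diagCond_iff {g n : ℕ} (hn : Even n) {γ : Matrix (Fin g ⊕ Fin g) (Fin g ⊕ Fin g) ℤ}
    (h : CongrOne g γ n) :
    DiagCond g γ (2 * n) ↔ (∀ i, ((2 * n : ℕ) : ℤ) ∣ γ (Sum.inl i) (Sum.inr i)) ∧
      ∀ i, ((2 * n : ℕ) : ℤ) ∣ γ (Sum.inr i) (Sum.inl i) := by
  have hb : ∀ i j, (n : ℤ) ∣ γ.toBlocks₁₂ i j := fun i j => by
    simpa [Matrix.toBlocks₁₂] using h (Sum.inl i) (Sum.inr j)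
  have hc : ∀ i j, (n : ℤ) ∣ γ.toBlocks₂₁ᵀ i j := fun i j => by
    simpa [Matrix.toBlocks₂₁] using h (Sum.inr j) (Sum.inl i)
  have ha : ∀ i j, (n : ℤ) ∣ (γ.toBlocks₁₁ - 1)ᵀ i j := fun i j => by
    simpa [Matrix.one_apply, Matrix.toBlocks₁₁] using h (Sum.inl j) (Sum.inl i)
  have hd : ∀ i j, (n : ℤ) ∣ (γ.toBlocks₂₂ - 1) i j := fun i j => by
    simpa [Matrix.one_apply, Matrix.toBlocks₂₂] using h (Sum.inr i) (Sum.inr j)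
  have hab : γ.toBlocks₁₁ᵀ * γ.toBlocks₁₂ =
      (γ.toBlocks₁₁ - 1)ᵀ * γ.toBlocks₁₂ + γ.toBlocks₁₂ := by
    simp [Matrix.sub_mul]
  have hcd : γ.toBlocks₂₁ᵀ * γ.toBlocks₂₂ =
      γ.toBlocks₂₁ᵀ * (γ.toBlocks₂₂ - 1) + γ.toBlocks₂₁ᵀ := by
    simp [Matrix.mul_sub]
  refine and_congr (forall_congr' fun i => ?_) (forall_congr' fun i => ?_)
  · rw [hab, Matrix.add_apply, dvd_add_right
      ((two_mul_dvd_mul_self hn).trans (mul_self_dvd_mul_apply ha hb i i))]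
    rfl
  · rw [hcd, Matrix.add_apply, dvd_add_right
      ((two_mul_dvd_mul_self hn).trans (mul_self_dvd_mul_apply hc hd i i))]
    rfl

theorem CongrOne.mul {g n : ℕ} {γ₁ γ₂ : Matrix (Fin g ⊕ Fin g) (Fin g ⊕ Fin g) ℤ}
    (h₁ : CongrOne g γ₁ n) (h₂ : CongrOne g γ₂ n) : CongrOne g (γ₁ * γ₂) n := fun i j => by
  have h := (dvd_mul_right (n : ℤ) n).trans (mul_sub_one_dvd h₁ h₂ i j)
  simp only [Matrix.sub_apply] at h
  exact (dvd_sub_left (h₁ i j)).1 ((dvd_sub_left (h₂ i j)).1 h)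

theorem CongrOne.inv {g n : ℕ} {γ : Matrix (Fin g ⊕ Fin g) (Fin g ⊕ Fin g) ℤ} (hγ : γ ∈ Sp g)
    (h : CongrOne g γ n) : CongrOne g γ⁻¹ n := by
  rw [inv_eq_fromBlocks hγ]
  rintro (i | i) (j | j)
  · simpa [Matrix.one_apply, eq_comm, Matrix.toBlocks₂₂] using h (Sum.inr j) (Sum.inr i)
  · simpa [Matrix.toBlocks₁₂] using h (Sum.inl j) (Sum.inr i)
  · simpa [Matrix.toBlocks₂₁] using h (Sum.inr j) (Sum.inl i)
  · simpa [Matrix.one_apply, eq_comm, Matrix.toBlocks₁₁] using h (Sum.inl j) (Sum.inl i)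

theorem DiagCond.mul {g n : ℕ} (hn : Even n)
    {γ₁ γ₂ : Matrix (Fin g ⊕ Fin g) (Fin g ⊕ Fin g) ℤ}
    (h₁ : CongrOne g γ₁ n) (h₂ : CongrOne g γ₂ n)
    (hd₁ : DiagCond g γ₁ (2 * n)) (hd₂ : DiagCond g γ₂ (2 * n)) :
    DiagCond g (γ₁ * γ₂) (2 * n) := by
  rw [diagCond_iff hn h₁] at hd₁
  rw [diagCond_iff hn h₂] at hd₂
  rw [diagCond_iff hn (h₁.mul h₂)]
  have key : ∀ i j, i ≠ j → ((2 * n : ℕ) : ℤ) ∣ γ₁ i j → ((2 * n : ℕ) : ℤ) ∣ γ₂ i j →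
      ((2 * n : ℕ) : ℤ) ∣ (γ₁ * γ₂) i j := fun i j hij hx hy => by
    have h := (two_mul_dvd_mul_self hn).trans (mul_sub_one_dvd h₁ h₂ i j)
    simp only [Matrix.sub_apply, Matrix.one_apply_ne hij, sub_zero] at h
    exact (dvd_sub_left hx).1 ((dvd_sub_left hy).1 h)
  exact ⟨fun i => key _ _ Sum.inl_ne_inr (hd₁.1 i) (hd₂.1 i),
    fun i => key _ _ Sum.inr_ne_inl (hd₁.2 i) (hd₂.2 i)⟩

theorem DiagCond.inv {g n : ℕ} (hn : Even n) {γ : Matrix (Fin g ⊕ Fin g) (Fin g ⊕ Fin g) ℤ}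
    (hγ : γ ∈ Sp g) (h : CongrOne g γ n) (hd : DiagCond g γ (2 * n)) :
    DiagCond g γ⁻¹ (2 * n) := by
  rw [diagCond_iff hn h] at hd
  rw [diagCond_iff hn (h.inv hγ), inv_eq_fromBlocks hγ]
  exact ⟨fun i => (dvd_neg (α := ℤ)).2 (hd.1 i), fun i => (dvd_neg (α := ℤ)).2 (hd.2 i)⟩

theorem statement17 {g : ℕ} (hg : 1 ≤ g) (n : ℕ) (hn : 0 < n) (hne : Even n) :
    (1 : Matrix (Fin g ⊕ Fin g) (Fin g ⊕ Fin g) ℤ) ∈ GammaSet g n ∧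
      (∀ γ₁ ∈ GammaSet g n, ∀ γ₂ ∈ GammaSet g n, γ₁ * γ₂ ∈ GammaSet g n) ∧
      (∀ γ ∈ GammaSet g n, γ⁻¹ ∈ GammaSet g n) := by
  refine ⟨?_, ?_, ?_⟩
  · have h_one : CongrOne g 1 n := fun i j => by simp
    exact ⟨mem_Sp_iff.2 (one_mem _), h_one, (diagCond_iff hne h_one).2 (by simp)⟩
  · rintro γ₁ ⟨hs₁, h₁, hd₁⟩ γ₂ ⟨hs₂, h₂, hd₂⟩
    exact ⟨mem_Sp_iff.2 (mul_mem (mem_Sp_iff.1 hs₁) (mem_Sp_iff.1 hs₂)), h₁.mul h₂,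
      DiagCond.mul hne h₁ h₂ hd₁ hd₂⟩
  · rintro γ ⟨hs, h, hd⟩
    exact ⟨inv_mem_Sp hs, h.inv hs, DiagCond.inv hne hs h hd⟩
end
end

section
/- Let g ≥ 1. The subgroup Γ_g(4,8) := { γ = (a b; c d) ∈ Sp(2g,ℤ) : γ ≡ I mod 4, diag(aᵀb) ≡ 0 mod 8, diag(cᵀd) ≡ 0 mod 8 } is a normal subgroup of Sp(2g,ℤ): for every γ ∈ Sp(2g,ℤ) and every δ ∈ Γ_g(4,8), the conjugate γδγ^{−1} lies in Γ_g(4,8). -/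
open scoped Matrix

noncomputable section

lemma Jmat_transpose (g : ℕ) : (Jmat g)ᵀ = -Jmat g := by
  simp [Jmat, Matrix.fromBlocks_transpose, Matrix.fromBlocks_neg]

lemma Jmat_mul_Jmat (g : ℕ) : Jmat g * Jmat g = -1 := by
  rw [← Matrix.fromBlocks_one, Matrix.fromBlocks_neg]
  simp [Jmat, Matrix.fromBlocks_multiply]

/-- A quadratic form whose matrix is symmetric with zero diagonal modulo `2` takes even values. -/
lemma even_dotProduct_mulVec {ι : Type*} [Fintype ι] [DecidableEq ι] {S : Matrix ι ι ℤ}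
    (hsymm : ∀ i j, (2 : ℤ) ∣ S i j - S j i) (hdiag : ∀ i, (2 : ℤ) ∣ S i i) (u : ι → ℤ) :
    (2 : ℤ) ∣ u ⬝ᵥ S *ᵥ u := by
  have hsymm' : ∀ i j, (S i j : ZMod 2) = S j i := fun i j => by
    have := (ZMod.intCast_zmod_eq_zero_iff_dvd (S i j - S j i) 2).2 (hsymm i j)
    push_cast at this
    exact sub_eq_zero.1 this
  have hdiag' : ∀ i, (S i i : ZMod 2) = 0 := fun i =>
    (ZMod.intCast_zmod_eq_zero_iff_dvd (S i i) 2).2 (hdiag i)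
  refine (ZMod.intCast_zmod_eq_zero_iff_dvd _ 2).1 ?_
  simp only [dotProduct, Matrix.mulVec, Finset.mul_sum]
  push_cast
  rw [← Finset.sum_product']
  refine Finset.sum_involution (fun p _ => p.swap) ?_ ?_ (by simp) (by simp)
  · rintro ⟨i, j⟩ -
    simp only [Prod.fst_swap, Prod.snd_swap]
    rw [hsymm' j i, show (u j * (S i j * u i) : ZMod 2) = u i * (S i j * u j) by ring]
    exact CharTwo.add_self_eq_zero _
  · rintro ⟨i, j⟩ - hne heq
    obtain rfl : j = i := congrArg Prod.fst heq
    simp [hdiag'] at hne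

lemma congrOne_iff {g n : ℕ} {δ : Matrix (Fin g ⊕ Fin g) (Fin g ⊕ Fin g) ℤ} :
    CongrOne g δ n ↔ ∃ X, δ = 1 + (n : ℤ) • X := by
  constructor
  · intro h
    choose X hX using h
    refine ⟨Matrix.of X, ?_⟩
    ext i j
    simp only [Matrix.add_apply, Matrix.smul_apply, Matrix.of_apply, smul_eq_mul, ← hX]
    ring
  · rintro ⟨X, rfl⟩ i j
    rw [Matrix.add_apply, add_sub_cancel_left, Matrix.smul_apply, smul_eq_mul]
    exact dvd_mul_right _ _

/-- For `n` even, the diagonal condition on `1 + n X` says that the diagonal of `J X` is even. -/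
lemma diagCond_one_add_smul_iff {g n : ℕ} (hn : Even n) (hn0 : n ≠ 0)
    (X : Matrix (Fin g ⊕ Fin g) (Fin g ⊕ Fin g) ℤ) :
    DiagCond g (1 + (n : ℤ) • X) (2 * n) ↔ ∀ i, (2 : ℤ) ∣ (Jmat g * X) i i := by
  obtain ⟨m, rfl⟩ := hn
  have hn0' : ((m + m : ℕ) : ℤ) ≠ 0 := by exact_mod_cast hn0
  have hdvd : ∀ s t : ℤ, ((2 * (m + m) : ℕ) : ℤ) ∣
      ((m + m : ℕ) : ℤ) * s + ((m + m : ℕ) : ℤ) * (((m + m : ℕ) : ℤ) * t) ↔ 2 ∣ s := by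
    intro s t
    rw [← mul_add, Nat.mul_comm, Nat.cast_mul, mul_dvd_mul_iff_left hn0']
    refine (dvd_add_left (Dvd.intro (m * t) ?_))
    push_cast
    ring
  rw [← Matrix.fromBlocks_toBlocks X]
  set A := X.toBlocks₁₁
  set B := X.toBlocks₁₂
  set C := X.toBlocks₂₁
  set D := X.toBlocks₂₂
  rw [← Matrix.fromBlocks_one, Matrix.fromBlocks_smul, Matrix.fromBlocks_add, Jmat,
    Matrix.fromBlocks_multiply]
  have hB : ∀ i,
      ((1 + ((m + m : ℕ) : ℤ) • A)ᵀ * (0 + ((m + m : ℕ) : ℤ) • B) : Matrix (Fin g) (Fin g) ℤ) i i =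
      ((m + m : ℕ) : ℤ) * B i i + ((m + m : ℕ) : ℤ) * (((m + m : ℕ) : ℤ) * (Aᵀ * B) i i) := by
    intro i
    simp only [Matrix.transpose_add, Matrix.transpose_one, Matrix.transpose_smul, zero_add,
      Matrix.add_mul, Matrix.one_mul, Matrix.smul_mul, Matrix.mul_smul, Matrix.add_apply,
      Matrix.smul_apply, smul_eq_mul, mul_add]
  have hC : ∀ i,
      ((0 + ((m + m : ℕ) : ℤ) • C)ᵀ * (1 + ((m + m : ℕ) : ℤ) • D) : Matrix (Fin g) (Fin g) ℤ) i i =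
      ((m + m : ℕ) : ℤ) * C i i + ((m + m : ℕ) : ℤ) * (((m + m : ℕ) : ℤ) * (Cᵀ * D) i i) := by
    intro i
    simp only [Matrix.transpose_smul, zero_add, Matrix.mul_add, Matrix.mul_one, Matrix.smul_mul,
      Matrix.mul_smul, Matrix.add_apply, Matrix.smul_apply, smul_eq_mul, Matrix.transpose_apply]
  simp only [DiagCond, Matrix.toBlocks_fromBlocks₁₁, Matrix.toBlocks_fromBlocks₁₂,
    Matrix.toBlocks_fromBlocks₂₁, Matrix.toBlocks_fromBlocks₂₂, hB, hC, hdvd, Sum.forall]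
  simp [and_comm]

/-- If `1 + n X` is symplectic with `n` even and nonzero, then `J X` is symmetric modulo `2`. -/
lemma two_dvd_Jmat_mul_sub {g n : ℕ} (hn : Even n) (hn0 : n ≠ 0)
    {X : Matrix (Fin g ⊕ Fin g) (Fin g ⊕ Fin g) ℤ} (hX : 1 + (n : ℤ) • X ∈ Sp g)
    (i j : Fin g ⊕ Fin g) : (2 : ℤ) ∣ (Jmat g * X) i j - (Jmat g * X) j i := by
  have hn0' : (n : ℤ) ≠ 0 := by exact_mod_cast hn0
  have h2 : (2 : ℤ) ∣ n := by exact_mod_cast hn.two_dvd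
  have hS : Xᵀ * Jmat g = -(Jmat g * X)ᵀ := by
    rw [Matrix.transpose_mul, Jmat_transpose, Matrix.mul_neg, neg_neg]
  have h : (1 + (n : ℤ) • X)ᵀ * Jmat g * (1 + (n : ℤ) • X) = Jmat g := hX
  simp only [Matrix.transpose_add, Matrix.transpose_one, Matrix.transpose_smul, Matrix.add_mul,
    Matrix.mul_add, Matrix.one_mul, Matrix.mul_one, Matrix.smul_mul, Matrix.mul_smul, hS] at h
  have hij := congrFun (congrFun h i) j
  simp only [Matrix.add_apply, Matrix.smul_apply, smul_eq_mul, Matrix.neg_apply, Matrix.neg_mul,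
    Matrix.transpose_apply] at hij
  refine h2.trans ⟨((Jmat g * X)ᵀ * X) i j, mul_left_cancel₀ hn0' ?_⟩
  linear_combination hij

lemma neg_Jmat_mul_transpose_mul_Jmat_mul {g : ℕ} {γ : Matrix (Fin g ⊕ Fin g) (Fin g ⊕ Fin g) ℤ}
    (hγ : γ ∈ Sp g) : -(Jmat g * γᵀ * Jmat g) * γ = 1 := by
  have h : γᵀ * Jmat g * γ = Jmat g := hγ
  rw [Matrix.neg_mul, Matrix.mul_assoc (Jmat g), Matrix.mul_assoc (Jmat g), h, Jmat_mul_Jmat,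
    neg_neg]

lemma Sp.inv_mul {g : ℕ} {γ : Matrix (Fin g ⊕ Fin g) (Fin g ⊕ Fin g) ℤ} (hγ : γ ∈ Sp g) :
    γ⁻¹ * γ = 1 := by
  rw [Matrix.inv_eq_left_inv (neg_Jmat_mul_transpose_mul_Jmat_mul hγ),
    neg_Jmat_mul_transpose_mul_Jmat_mul hγ]

lemma Sp.mul_inv {g : ℕ} {γ : Matrix (Fin g ⊕ Fin g) (Fin g ⊕ Fin g) ℤ} (hγ : γ ∈ Sp g) :
    γ * γ⁻¹ = 1 :=
  mul_eq_one_comm.1 (Sp.inv_mul hγ)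

lemma Sp.Jmat_mul {g : ℕ} {γ : Matrix (Fin g ⊕ Fin g) (Fin g ⊕ Fin g) ℤ} (hγ : γ ∈ Sp g) :
    Jmat g * γ = (γ⁻¹)ᵀ * Jmat g := by
  have h : γᵀ * Jmat g * γ = Jmat g := hγ
  conv_rhs => rw [← h]
  rw [Matrix.mul_assoc γᵀ, ← Matrix.mul_assoc, ← Matrix.transpose_mul, Sp.mul_inv hγ,
    Matrix.transpose_one, Matrix.one_mul]

lemma Sp.mul_mem {g : ℕ} {γ δ : Matrix (Fin g ⊕ Fin g) (Fin g ⊕ Fin g) ℤ} (hγ : γ ∈ Sp g)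
    (hδ : δ ∈ Sp g) : γ * δ ∈ Sp g := by
  have h : γᵀ * Jmat g * γ = Jmat g := hγ
  have h' : δᵀ * Jmat g * δ = Jmat g := hδ
  change (γ * δ)ᵀ * Jmat g * (γ * δ) = Jmat g
  calc (γ * δ)ᵀ * Jmat g * (γ * δ) = δᵀ * (γᵀ * Jmat g * γ) * δ := by
        simp only [Matrix.transpose_mul, Matrix.mul_assoc]
    _ = Jmat g := by rw [h, h']

lemma Sp.inv_mem {g : ℕ} {γ : Matrix (Fin g ⊕ Fin g) (Fin g ⊕ Fin g) ℤ} (hγ : γ ∈ Sp g) :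
    γ⁻¹ ∈ Sp g := by
  change (γ⁻¹)ᵀ * Jmat g * γ⁻¹ = Jmat g
  rw [← Sp.Jmat_mul hγ, Matrix.mul_assoc, Sp.mul_inv hγ, Matrix.mul_one]

/-- For `n` even and nonzero, `Γ_g(n,2n)` is stable under conjugation by `Sp(2g,ℤ)`. -/
lemma conj_mem_GammaSet {g n : ℕ} (hn : Even n) (hn0 : n ≠ 0)
    {γ δ : Matrix (Fin g ⊕ Fin g) (Fin g ⊕ Fin g) ℤ} (hγ : γ ∈ Sp g) (hδ : δ ∈ GammaSet g n) :
    γ * δ * γ⁻¹ ∈ GammaSet g n := by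
  obtain ⟨hSp, hcongr, hdiag⟩ := hδ
  obtain ⟨X, rfl⟩ := congrOne_iff.1 hcongr
  have hconj : γ * (1 + (n : ℤ) • X) * γ⁻¹ = 1 + (n : ℤ) • (γ * X * γ⁻¹) := by
    rw [Matrix.mul_add, Matrix.add_mul, Matrix.mul_one, Sp.mul_inv hγ, Matrix.mul_smul,
      Matrix.smul_mul]
  refine ⟨Sp.mul_mem (Sp.mul_mem hγ hSp) (Sp.inv_mem hγ), congrOne_iff.2 ⟨_, hconj⟩, ?_⟩
  rw [hconj, diagCond_one_add_smul_iff hn hn0]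
  rw [diagCond_one_add_smul_iff hn hn0] at hdiag
  intro i
  have hJ : Jmat g * (γ * X * γ⁻¹) = (γ⁻¹)ᵀ * ((Jmat g * X) * γ⁻¹) := by
    simp only [← Matrix.mul_assoc, Sp.Jmat_mul hγ]
  rw [hJ]
  exact even_dotProduct_mulVec (two_dvd_Jmat_mul_sub hn hn0 hSp) hdiag fun k => γ⁻¹ k i

theorem statement18 {g : ℕ} (hg : 1 ≤ g) :
    ∀ γ ∈ Sp g, ∀ δ ∈ GammaSet g 4, γ * δ * γ⁻¹ ∈ GammaSet g 4 :=
  fun _ hγ _ hδ => conj_mem_GammaSet (by decide) (by decide) hγ hδ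
end
end
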